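/- For all n, f ≥ 0, the number of permutations π of [n] that avoid 231 and 32-1 and have exactly f fixed points equals the number of Motzkin paths P of length n such that h₀(P) + g(P) = f, where h₀(P) is the number of horizontal steps of P at height 0 and g(P) is the number of tunnels T of P whose length exceeds their height by exactly 1 (i.e., tunnels of height k and length k+1 for some k ≥ 1). -/

import Mathlib

/-- Steps of a Motzkin path. -/
inductive MStep : Type
  | up : MStep
  | hor : MStep
  | down : MStep
deriving DecidableEq

/-- The height change of a Motzkin-path step. -/
def mval : MStep → ℤ
  | .up => 1
  | .hor => 0
  | .down => -1

/-- A Motzkin path: ends at height 0 and never goes below 0. -/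
def IsMotzkinPath (P : List MStep) : Prop :=
  (P.map mval).sum = 0 ∧ ∀ p : List MStep, p <+: P → 0 ≤ (p.map mval).sum

/-- The number of horizontal steps of `P` at height 0. -/
noncomputable def horAtZero (P : List MStep) : ℕ :=
  Nat.card {AC : List MStep × List MStep //
    P = AC.1 ++ (MStep.hor :: AC.2) ∧ (AC.1.map mval).sum = 0}

/-- The number of tunnels of `P` whose length exceeds their height by exactly 1.
A tunnel is a decomposition `P = A ++ u ++ B ++ d ++ C` with `B` a Motzkin path;
its height is the height where `u` starts (the sum of `A`) and its length is `|B| + 2`. -/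
noncomputable def goodTunnels (P : List MStep) : ℕ :=
  Nat.card {ABC : List MStep × List MStep × List MStep //
    P = ABC.1 ++ (MStep.up :: (ABC.2.1 ++ (MStep.down :: ABC.2.2))) ∧
    IsMotzkinPath ABC.2.1 ∧
    (ABC.1.map mval).sum = (ABC.2.1.length : ℤ) + 1}

/-- `π` avoids the classical pattern 231. -/
def Avoids231 {n : ℕ} (π : Equiv.Perm (Fin n)) : Prop :=
  ¬ ∃ i j k : Fin n, i < j ∧ j < k ∧ π k < π i ∧ π i < π j

/-- `π` avoids the generalized pattern 32-1: no `a` and `b` with `a+1 < b` and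
`π a > π (a+1) > π b`. -/
def Avoids32_1 {n : ℕ} (π : Equiv.Perm (Fin n)) : Prop :=
  ¬ ∃ (a b : Fin n) (h : (a : ℕ) + 1 < n),
    (⟨(a : ℕ) + 1, h⟩ : Fin n) < b ∧ π b < π ⟨(a : ℕ) + 1, h⟩ ∧ π ⟨(a : ℕ) + 1, h⟩ < π a

/-- The number of fixed points of `π`. -/
noncomputable def fp {n : ℕ} (π : Equiv.Perm (Fin n)) : ℕ :=
  Nat.card {i : Fin n // π i = i}

/-- Binary-unary trees encoding Motzkin paths. -/
inductive MT : Type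
  | nil : MT
  | hor : MT → MT
  | ud : MT → MT → MT

namespace MT

/-- Size. -/
def size : MT → ℕ
  | nil => 0
  | hor t => t.size + 1
  | ud t b => t.size + (b.size + 2)

/-- The statistic of a tree placed at height `k`. -/
def st : ℕ → MT → ℕ
  | _, nil => 0
  | k, hor t => st k t + (if k = 0 then 1 else 0)
  | k, ud t b => st k t + (st (k+1) b + (if k = b.size + 1 then 1 else 0))

/-- The path of a tree. -/
def L : MT → List MStep
  | nil => []
  | hor t => MStep.hor :: L t
  | ud t b => MStep.up :: (L b ++ MStep.down :: L t)

/-- The permutation of a tree. -/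
def F : MT → ℕ → ℕ
  | nil => fun i => i
  | hor t => F t
  | ud t b => fun i => if i < t.size then F t i else if i = t.size then t.size + b.size + 1
      else if i = t.size + 1 then t.size
      else if i < t.size + b.size + 2 then F b (i - t.size - 2) + t.size + 1 else i

/-- Parser of paths. -/
def parse : List MStep → List MT
  | [] => [nil]
  | MStep.hor :: Q => match parse Q with
    | t :: ts => hor t :: ts
    | [] => []
  | MStep.up :: Q => match parse Q with
    | t0 :: t1 :: ts => ud t1 t0 :: ts
    | _ => []
  | MStep.down :: Q => nil :: parse Q

theorem parse_L (t : MT) : ∀ (R : List MStep) (s : List MT), parse R = nil :: s →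
    parse (L t ++ R) = t :: s := by
  induction t with
  | nil => intro R s h; simpa [L] using h
  | hor t ih => intro R s h; simp [L, parse, ih R s h]
  | ud t b iht ihb =>
    intro R s h
    have h1 := iht R s h
    have h2 := ihb (MStep.down :: (L t ++ R)) (t :: s) (by simp [parse, h1])
    simp [L, parse, h2]

theorem L_inj {t t' : MT} (h : L t = L t') : t = t' := by
  have h1 := parse_L t [] [] rfl
  have h2 := parse_L t' [] [] rfl
  rw [h, h2] at h1
  simpa using h1.symm

theorem parse_L_down (t : MT) (R : List MStep) :
    parse (L t ++ MStep.down :: R) = t :: parse R :=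
  parse_L t _ _ rfl

theorem length_L (t : MT) : (L t).length = t.size := by
  induction t with
  | nil => rfl
  | hor t ih => simp [L, size, ih]
  | ud t b iht ihb => simp [L, size, iht, ihb]; omega

theorem sum_L (t : MT) : ((L t).map mval).sum = 0 := by
  induction t with
  | nil => rfl
  | hor t ih => simp [L, mval, ih]
  | ud t b iht ihb => simp [L, mval, iht, ihb]

end MT

open MT

/-- Paths from height `h` to `0`. -/
def Mz (h : ℤ) (P : List MStep) : Prop :=
  h + (P.map mval).sum = 0 ∧ ∀ p : List MStep, p <+: P → 0 ≤ h + (p.map mval).sum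

theorem isM_iff (P : List MStep) : IsMotzkinPath P ↔ Mz 0 P := by
  simp [IsMotzkinPath, Mz]

theorem Mz_nil (h : ℤ) : Mz h [] ↔ h = 0 := by
  simp [Mz]; omega

theorem Mz_cons (h : ℤ) (s : MStep) (P : List MStep) :
    Mz h (s :: P) ↔ 0 ≤ h ∧ Mz (h + mval s) P := by
  constructor
  · rintro ⟨h1, h2⟩
    refine ⟨by simpa using h2 [] (by simp), ?_, ?_⟩
    · simp at h1; omega
    · intro p hp
      have := h2 (s :: p) (by simpa using hp)
      simp at this; omega
  · rintro ⟨h0, h1, h2⟩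
    refine ⟨by simp; omega, ?_⟩
    intro p hp
    cases p with
    | nil => simpa using h0
    | cons a p =>
      rw [List.cons_prefix_cons] at hp
      have := h2 p hp.2
      rw [hp.1]; simp; omega

theorem Mz_nonneg {h : ℤ} {P : List MStep} (H : Mz h P) : 0 ≤ h := by
  simpa using H.2 [] (by simp)

theorem Mz_L (t : MT) : ∀ (h : ℤ) (R : List MStep), Mz h R → Mz h (L t ++ R) := by
  induction t with
  | nil => intro h R H; simpa [L] using H
  | hor t ih =>
    intro h R H
    simp only [L, List.cons_append, Mz_cons]
    exact ⟨Mz_nonneg H, by simpa [mval] using ih h R H⟩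
  | ud t b iht ihb =>
    intro h R H
    have h0 := Mz_nonneg H
    simp only [L, List.cons_append, List.append_assoc, Mz_cons]
    refine ⟨h0, ihb _ _ ?_⟩
    rw [Mz_cons]
    refine ⟨by simp [mval]; omega, ?_⟩
    simpa [mval] using iht h R H

theorem isM_L (t : MT) : IsMotzkinPath (L t) := by
  rw [isM_iff]
  simpa using Mz_L t 0 [] (by simp [Mz_nil])

/-- Stack of trees to path. -/
def LL : MT → List MT → List MStep
  | t, [] => L t
  | t, t' :: ts => L t ++ MStep.down :: LL t' ts

theorem exists_LL (Q : List MStep) : ∀ h : ℕ, Mz h Q →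
    ∃ t ts, ts.length = h ∧ LL t ts = Q := by
  induction Q with
  | nil =>
    intro h H
    rw [Mz_nil] at H
    exact ⟨nil, [], by simp; omega, rfl⟩
  | cons s Q ih =>
    intro h H
    rw [Mz_cons] at H
    cases s with
    | hor =>
      obtain ⟨t, ts, h1, h2⟩ := ih h (by simpa [mval] using H.2)
      refine ⟨hor t, ts, h1, ?_⟩
      rw [← h2]
      cases ts <;> simp [LL, L]
    | up =>
      obtain ⟨t, ts, h1, h2⟩ := ih (h+1) (by simpa [mval] using H.2)
      cases ts with
      | nil => simp at h1
      | cons t' ts =>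
        refine ⟨ud t' t, ts, by simpa using h1, ?_⟩
        rw [← h2]
        cases ts <;> simp [LL, L]
    | down =>
      have hn := Mz_nonneg H.2
      simp only [mval] at hn
      obtain ⟨h, rfl⟩ : ∃ h', h = h' + 1 := ⟨h - 1, by omega⟩
      obtain ⟨t, ts, h1, h2⟩ := ih h (by simpa [mval] using H.2)
      exact ⟨nil, t :: ts, by simp [h1], by simp [LL, L, h2]⟩

theorem exists_L {P : List MStep} (h : IsMotzkinPath P) : ∃ t, L t = P := by
  rw [isM_iff] at h
  obtain ⟨t, ts, h1, h2⟩ := exists_LL P 0 h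
  rw [List.length_eq_zero_iff] at h1
  subst h1
  exact ⟨t, h2⟩

/-- Horizontal steps at height zero, starting at height `k`. -/
def HS (k : ℤ) (P : List MStep) : Set (List MStep × List MStep) :=
  {AC | P = AC.1 ++ (MStep.hor :: AC.2) ∧ k + (AC.1.map mval).sum = 0}

/-- Good tunnels, starting at height `k`. -/
def GS (k : ℤ) (P : List MStep) : Set (List MStep × List MStep × List MStep) :=
  {ABC | P = ABC.1 ++ (MStep.up :: (ABC.2.1 ++ (MStep.down :: ABC.2.2))) ∧
    IsMotzkinPath ABC.2.1 ∧
    k + (ABC.1.map mval).sum = (ABC.2.1.length : ℤ) + 1}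

theorem HS_nil (k : ℤ) : (HS k []).encard = 0 := by
  rw [Set.encard_eq_zero]
  ext ⟨A, C⟩
  simp [HS]

theorem GS_nil (k : ℤ) : (GS k []).encard = 0 := by
  rw [Set.encard_eq_zero]
  ext ⟨A, C⟩
  simp [GS]

theorem HS_cons (k : ℤ) (s : MStep) (P : List MStep) :
    (HS k (s :: P)).encard =
      (HS (k + mval s) P).encard + {AC ∈ HS k (s :: P) | AC.1 = []}.encard := by
  have hinj : Function.Injective (fun AC : List MStep × List MStep => (s :: AC.1, AC.2)) := by
    rintro ⟨A, C⟩ ⟨A', C'⟩ h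
    simpa using h
  rw [← hinj.encard_image (HS (k + mval s) P), ← Set.encard_union_eq]
  · congr 1
    ext ⟨A, C⟩
    cases A with
    | nil => simp [HS]
    | cons a A =>
      simp only [HS, Set.mem_ofPred_eq, Set.mem_union, Set.mem_image, Prod.mk.injEq, Prod.exists,
        List.cons_append, List.cons.injEq, List.map_cons, List.sum_cons]
      constructor
      · rintro ⟨⟨rfl, h⟩, h2⟩
        exact Or.inl ⟨A, C, ⟨h, by omega⟩, ⟨rfl, rfl⟩, rfl⟩
      · rintro (⟨A', C', ⟨h, h2⟩, ⟨rfl, rfl⟩, rfl⟩ | h)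
        · exact ⟨⟨rfl, h⟩, by omega⟩
        · simp at h
  · rw [Set.disjoint_left]
    rintro ⟨A, C⟩ ⟨⟨A', C'⟩, _, h⟩ ⟨_, h2⟩
    simp at h h2
    simp [h2] at h

theorem GS_cons (k : ℤ) (s : MStep) (P : List MStep) :
    (GS k (s :: P)).encard =
      (GS (k + mval s) P).encard + {AC ∈ GS k (s :: P) | AC.1 = []}.encard := by
  have hinj : Function.Injective
      (fun AC : List MStep × List MStep × List MStep => (s :: AC.1, AC.2)) := by
    rintro ⟨A, C⟩ ⟨A', C'⟩ h
    simpa using h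
  rw [← hinj.encard_image (GS (k + mval s) P), ← Set.encard_union_eq]
  · congr 1
    ext ⟨A, B, C⟩
    cases A with
    | nil => simp [GS]
    | cons a A =>
      simp only [GS, Set.mem_ofPred_eq, Set.mem_union, Set.mem_image, Prod.mk.injEq, Prod.exists,
        List.cons_append, List.cons.injEq, List.map_cons, List.sum_cons]
      constructor
      · rintro ⟨⟨rfl, h⟩, h1, h2⟩
        exact Or.inl ⟨A, B, C, ⟨h, h1, by omega⟩, ⟨rfl, rfl⟩, rfl, rfl⟩
      · rintro (⟨A', B', C', ⟨h, h1, h2⟩, ⟨rfl, rfl⟩, rfl, rfl⟩ | h)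
        · exact ⟨⟨rfl, h⟩, h1, by omega⟩
        · simp at h
  · rw [Set.disjoint_left]
    rintro ⟨A, C⟩ ⟨⟨A', C'⟩, _, h⟩ ⟨_, h2⟩
    simp at h h2
    simp [h2] at h

theorem HS_ne (k : ℤ) (s : MStep) (hs : s ≠ .hor) (P : List MStep) :
    (HS k (s :: P)).encard = (HS (k + mval s) P).encard := by
  rw [HS_cons]
  have : {AC ∈ HS k (s :: P) | AC.1 = []} = ∅ := by
    ext ⟨A, C⟩
    simp only [HS, Set.mem_ofPred_eq, Set.mem_empty_iff_false, iff_false]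
    rintro ⟨⟨h, _⟩, rfl⟩
    simp at h
    exact hs h.1
  simp [this]

theorem GS_ne (k : ℤ) (s : MStep) (hs : s ≠ .up) (P : List MStep) :
    (GS k (s :: P)).encard = (GS (k + mval s) P).encard := by
  rw [GS_cons]
  have : {AC ∈ GS k (s :: P) | AC.1 = []} = ∅ := by
    ext ⟨A, C⟩
    simp only [GS, Set.mem_ofPred_eq, Set.mem_empty_iff_false, iff_false]
    rintro ⟨⟨h, _⟩, rfl⟩
    simp at h
    exact hs h.1
  simp [this]

theorem HS_hor (k : ℕ) (P : List MStep) :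
    (HS k (.hor :: P)).encard = (HS k P).encard + ((if k = 0 then 1 else 0 : ℕ) : ℕ∞) := by
  rw [HS_cons, show (k : ℤ) + mval .hor = k by simp [mval]]
  congr 1
  · split_ifs with hk
    · have : {AC ∈ HS k (.hor :: P) | AC.1 = []} = {([], P)} := by
        ext ⟨A, C⟩
        simp only [HS, Set.mem_ofPred_eq, Set.mem_singleton_iff, Prod.mk.injEq]
        constructor
        · rintro ⟨⟨h, _⟩, rfl⟩
          simp at h
          exact ⟨rfl, h.symm⟩
        · rintro ⟨rfl, rfl⟩
          simp [hk]
      simp [this]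
    · have : {AC ∈ HS k (.hor :: P) | AC.1 = []} = ∅ := by
        ext ⟨A, C⟩
        simp only [HS, Set.mem_ofPred_eq, Set.mem_empty_iff_false, iff_false]
        rintro ⟨⟨h, h2⟩, rfl⟩
        simp at h2
        omega
      simp [this]

theorem GS_up (k : ℕ) (b : MT) (P : List MStep) :
    (GS k (.up :: (L b ++ .down :: P))).encard =
      (GS ((k+1 : ℕ) : ℤ) (L b ++ .down :: P)).encard
        + ((if k = b.size + 1 then 1 else 0 : ℕ) : ℕ∞) := by
  rw [GS_cons]
  have key : ∀ B C, IsMotzkinPath B → L b ++ .down :: P = B ++ .down :: C → B = L b ∧ C = P := by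
    intro B C hB h
    obtain ⟨t, rfl⟩ := exists_L hB
    have h2 := congrArg parse h
    rw [parse_L_down, parse_L_down] at h2
    simp at h2
    rw [h2.1] at h ⊢
    simp at h
    exact ⟨rfl, h.symm⟩
  congr 1
  split_ifs with hk
  · have : {AC ∈ GS k (.up :: (L b ++ .down :: P)) | AC.1 = []} = {([], L b, P)} := by
      ext ⟨A, B, C⟩
      simp only [GS, Set.mem_ofPred_eq, Set.mem_singleton_iff, Prod.mk.injEq]
      constructor
      · rintro ⟨⟨h, h1, h2⟩, rfl⟩
        simp at h
        exact ⟨rfl, key _ _ h1 h⟩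
      · rintro ⟨rfl, rfl, rfl⟩
        simp [hk, isM_L, length_L]
    simp [this]
  · have : {AC ∈ GS k (.up :: (L b ++ .down :: P)) | AC.1 = []} = ∅ := by
      ext ⟨A, B, C⟩
      simp only [GS, Set.mem_ofPred_eq, Set.mem_empty_iff_false, iff_false]
      rintro ⟨⟨h, h1, h2⟩, rfl⟩
      simp at h
      obtain ⟨rfl, rfl⟩ := key _ _ h1 h
      simp [length_L] at h2
      omega
    simp [this]

theorem stat_L (t : MT) : ∀ (k : ℕ) (R : List MStep),
    (HS k (L t ++ R)).encard + (GS k (L t ++ R)).encard =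
      (st k t : ℕ∞) + ((HS k R).encard + (GS k R).encard) := by
  induction t with
  | nil => intro k R; simp [L, st]
  | hor t ih =>
    intro k R
    simp only [L, List.cons_append, st]
    rw [HS_hor, GS_ne _ _ (by simp), show (k : ℤ) + mval .hor = k by simp [mval], Nat.cast_add,
      add_right_comm, ih, add_right_comm]
  | ud t b iht ihb =>
    intro k R
    simp only [L, List.cons_append, List.append_assoc, st]
    rw [HS_ne _ _ (by simp), GS_up, show (k : ℤ) + mval .up = (k+1 : ℕ) by simp [mval],
      ← add_assoc, ihb, HS_ne _ _ (by simp), GS_ne _ _ (by simp),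
      show ((k+1 : ℕ) : ℤ) + mval .down = k by simp [mval], iht]
    push_cast
    ring

theorem stat_eq (t : MT) : horAtZero (L t) + goodTunnels (L t) = st 0 t := by
  have h := stat_L t 0 []
  simp only [List.append_nil, HS_nil, GS_nil, add_zero] at h
  have h1 : horAtZero (L t) = (HS (0:ℕ) (L t)).encard.toNat := by
    rw [← Set.ncard_def, ← Nat.card_coe_set_eq]
    simp only [HS, Nat.cast_zero, zero_add]
    rfl
  have h2 : goodTunnels (L t) = (GS (0:ℕ) (L t)).encard.toNat := by
    rw [← Set.ncard_def, ← Nat.card_coe_set_eq]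
    simp only [GS, Nat.cast_zero, zero_add]
    rfl
  have f1 : (HS (0:ℕ) (L t)).encard ≠ ⊤ := by
    intro h'; rw [h'] at h; simp at h
  have f2 : (GS (0:ℕ) (L t)).encard ≠ ⊤ := by
    intro h'; rw [h'] at h; simp at h
  rw [h1, h2, ← ENat.toNat_add f1 f2, h]
  simp

/-- Pattern avoiding permutations as functions on naturals. -/
structure IsG (n : ℕ) (g : ℕ → ℕ) : Prop where
  lt : ∀ i, i < n → g i < n
  inj : ∀ i j, i < n → j < n → g i = g j → i = j
  out : ∀ i, n ≤ i → g i = i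
  av : ∀ i j k, i < j → j < k → k < n → g k < g i → g i < g j → False
  av' : ∀ a b, a + 1 < b → b < n → g b < g (a+1) → g (a+1) < g a → False

theorem IsG.surj {n : ℕ} {g : ℕ → ℕ} (H : IsG n g) (v : ℕ) (hv : v < n) :
    ∃ i, i < n ∧ g i = v := by
  have h := Finset.surj_on_of_inj_on_of_card_le (s := Finset.range n) (t := Finset.range n)
    (fun i _ => g i) (fun i hi => by simpa using H.lt i (by simpa using hi))
    (fun i j hi hj h => H.inj i j (by simpa using hi) (by simpa using hj) h) le_rfl v
    (by simpa using hv)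
  obtain ⟨i, hi, h⟩ := h
  exact ⟨i, by simpa using hi, h.symm⟩

theorem F_lt (t b : MT) (i : ℕ) (hi : i < t.size) : F (ud t b) i = F t i := by
  simp [F, hi]

theorem F_at (t b : MT) : F (ud t b) t.size = t.size + b.size + 1 := by
  simp [F]

theorem F_at1 (t b : MT) : F (ud t b) (t.size + 1) = t.size := by
  simp [F]

theorem F_mid (t b : MT) (i : ℕ) (hi : i < b.size) :
    F (ud t b) (t.size + 2 + i) = F b i + t.size + 1 := by
  have : t.size + 2 + i - t.size - 2 = i := by omega
  simp only [F, this]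
  rw [if_neg (by omega), if_neg (by omega), if_neg (by omega), if_pos (by omega)]

theorem F_out (t b : MT) (i : ℕ) (hi : t.size + (b.size + 2) ≤ i) : F (ud t b) i = i := by
  simp only [F]
  rw [if_neg (by omega), if_neg (by omega), if_neg (by omega), if_neg (by omega)]

theorem isG_hor {n : ℕ} {g : ℕ → ℕ} (H : IsG n g) : IsG (n+1) g := by
  have hn := H.out n le_rfl
  have key : ∀ i, i < n + 1 → i = n ∨ i < n ∧ g i < n := by
    intro i hi
    rcases Nat.lt_or_ge i n with h | h
    · exact Or.inr ⟨h, H.lt i h⟩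
    · left; omega
  constructor
  · intro i hi
    rcases key i hi with rfl | h <;> omega
  · intro i j hi hj h
    rcases key i hi with rfl | h1 <;> rcases key j hj with rfl | h2
    · rfl
    · omega
    · omega
    · exact H.inj i j h1.1 h2.1 h
  · intro i hi; exact H.out i (by omega)
  · intro i j k hij hjk hk h1 h2
    rcases key i (by omega) with rfl | h3
    · omega
    rcases key k (by omega) with rfl | h4
    · omega
    exact H.av i j k hij hjk h4.1 h1 h2
  · intro a b hab hb h1 h2
    rcases key (a+1) (by omega) with h3 | h3
    · omega
    rcases key b (by omega) with rfl | h4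
    · omega
    exact H.av' a b hab h4.1 h1 h2

theorem isG_ud {s m : ℕ} {p q g : ℕ → ℕ} (Hp : IsG s p) (Hq : IsG m q)
    (g1 : ∀ i, i < s → g i = p i) (g2 : g s = s + m + 1) (g3 : g (s+1) = s)
    (g4 : ∀ i, i < m → g (s + 2 + i) = q i + s + 1)
    (g5 : ∀ i, s + (m + 2) ≤ i → g i = i) : IsG (s + (m+2)) g := by
  have key : ∀ i, i < s + (m+2) → (i < s ∧ g i = p i ∧ g i < s) ∨ (i = s ∧ g i = s + m + 1) ∨
      (i = s + 1 ∧ g i = s) ∨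
      (∃ i', i' < m ∧ i = s + 2 + i' ∧ g i = q i' + s + 1 ∧ q i' < m) := by
    intro i hi
    rcases Nat.lt_or_ge i s with h | h
    · have := Hp.lt i h
      have := g1 i h
      left; omega
    rcases Nat.lt_or_ge i (s+2) with h' | h'
    · rcases (by omega : i = s ∨ i = s + 1) with rfl | rfl
      · simp [g2]
      · simp [g3]
    · right; right; right
      refine ⟨i - (s+2), by omega, by omega, ?_, Hq.lt _ (by omega)⟩
      rw [← g4 _ (by omega)]
      congr 1; omega
  constructor
  · intro i hi
    rcases key i hi with h | h | h | ⟨i', h⟩ <;> omega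
  · intro i j hi hj h
    rcases key i hi with h1 | h1 | h1 | ⟨i', h1⟩ <;>
    rcases key j hj with h2 | h2 | h2 | ⟨j', h2⟩ <;> try omega
    · exact Hp.inj i j h1.1 h2.1 (by omega)
    · have := Hq.inj i' j' h1.1 h2.1 (by omega)
      omega
  · exact g5
  · intro i j k hij hjk hk h1 h2
    rcases key i (by omega) with h3 | h3 | h3 | ⟨i', h3⟩ <;>
    rcases key k (by omega) with h4 | h4 | h4 | ⟨k', h4⟩ <;> try omega
    · have := g1 j (by omega)
      exact Hp.av i j k hij hjk h4.1 (by omega) (by omega)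
    · rcases key j (by omega) with h5 | h5 | h5 | ⟨j', h5⟩ <;> omega
    · rcases key j (by omega) with h5 | h5 | h5 | ⟨j', h5⟩ <;> try omega
      exact Hq.av i' j' k' (by omega) (by omega) h4.1 (by omega) (by omega)
  · intro a b hab hb h1 h2
    rcases key a (by omega) with h3 | h3 | h3 | ⟨a', h3⟩ <;>
    rcases key b (by omega) with h4 | h4 | h4 | ⟨b', h4⟩ <;> try omega
    · have := g1 (a+1) (by omega)
      exact Hp.av' a b hab h4.1 (by omega) (by omega)
    · rcases key (a+1) (by omega) with h5 | h5 | h5 | ⟨j', h5⟩ <;> omega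
    · rcases key (a+1) (by omega) with h5 | h5 | h5 | ⟨j', h5⟩ <;> try omega
      obtain rfl : j' = a' + 1 := by omega
      exact Hq.av' a' b' (by omega) h4.1 (by omega) (by omega)

theorem isG_F (t : MT) : IsG t.size (F t) := by
  induction t with
  | nil =>
    constructor <;> simp [size, F]
  | hor t ih => exact isG_hor ih
  | ud t b iht ihb =>
    exact isG_ud iht ihb (F_lt t b) (F_at t b) (F_at1 t b) (F_mid t b) (F_out t b)

theorem F_inj (t : MT) : ∀ t' : MT, t.size = t'.size → F t = F t' → t = t' := by
  have aux : ∀ t t' b' : MT, t.size + 1 = t'.size + (b'.size + 2) → F t = F (ud t' b') → False := by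
    intro t t' b' hs h
    have h1 := (isG_F t).lt t'.size
    have h2 := F_at t' b'
    rw [← h] at h2
    omega
  induction t with
  | nil =>
    intro t' hs h
    cases t' <;> simp [size] at hs ⊢
  | hor t ih =>
    intro t' hs h
    cases t' with
    | nil => simp [size] at hs
    | hor t' => rw [ih t' (by simpa [size] using hs) h]
    | ud t' b' => exact (aux t t' b' hs h).elim
  | ud t b iht ihb =>
    intro t' hs h
    cases t' with
    | nil => simp [size] at hs
    | hor t' => exact (aux t' t b hs.symm h.symm).elim
    | ud t' b' =>
      simp only [size] at hs
      have e : t.size = t'.size := by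
        apply (isG_F (ud t b)).inj
        · simp [size]
        · simp only [size]; omega
        · rw [F_at, h, F_at]; omega
      have e1 : F t = F t' := by
        funext i
        rcases Nat.lt_or_ge i t.size with h1 | h1
        · rw [← F_lt t b i h1, h, F_lt t' b' i (by omega)]
        · rw [(isG_F t).out i h1, (isG_F t').out i (by omega)]
      have e2 : F b = F b' := by
        funext i
        rcases Nat.lt_or_ge i b.size with h1 | h1
        · have h2 := F_mid t b i h1
          have h3 := F_mid t' b' i (by omega)
          rw [h, e] at h2
          omega
        · rw [(isG_F b).out i h1, (isG_F b').out i (by omega)]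
      rw [iht t' e e1, ihb b' (by omega) e2]

theorem exists_F (n : ℕ) : ∀ g, IsG n g → ∃ t : MT, t.size = n ∧ F t = g := by
  induction n using Nat.strong_induction_on with
  | _ n ih =>
  intro g H
  rcases n with _ | n
  · exact ⟨nil, rfl, by funext i; simp [F, H.out i (by omega)]⟩
  obtain ⟨j, hj, hgj⟩ := H.surj n (by omega)
  have hlt : ∀ i, i < n + 1 → i ≠ j → g i < n := by
    intro i hi hij
    have h1 := H.lt i hi
    have h2 : g i ≠ n := fun h => hij (H.inj i j hi hj (by omega))
    omega
  rcases Nat.lt_or_ge j n with hjn | hjn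
  · -- the main case
    have hsep : ∀ i k, i < j → j < k → k < n + 1 → g i < g k := by
      intro i k hi hk hkn
      by_contra hc
      have h1 : g i ≠ g k := fun h => by have := H.inj i k (by omega) hkn h; omega
      exact H.av i j k hi hk hkn (by omega) (by rw [hgj]; exact hlt i (by omega) (by omega))
    have hlow : ∀ i, i < j → g i < j := by
      intro i hi
      by_contra hc
      have := Finset.card_le_card_of_injOn (s := Finset.Ioo j (n+1)) (t := Finset.Ioo j n) g
        (by
          intro k hk
          simp only [Finset.coe_Ioo, Set.mem_Ioo] at hk ⊢
          have := hsep i k hi hk.1 hk.2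
          have := hlt k hk.2 (by omega)
          omega)
        (by
          intro k hk l hl hkl
          simp only [Finset.coe_Ioo, Set.mem_Ioo] at hk hl
          exact H.inj k l hk.2 hl.2 hkl)
      simp at this
      omega
    have Hp : IsG j (fun i => if i < j then g i else i) := by
      constructor
      · intro i hi; simpa [hi] using hlow i hi
      · intro i k hi hk h
        simp only [hi, hk, if_true] at h
        exact H.inj i k (by omega) (by omega) h
      · intro i hi; simp; omega
      · intro a b c hab hbc hc h1 h2
        simp only [hc, show a < j by omega, show b < j by omega, if_true] at h1 h2
        exact H.av a b c hab hbc (by omega) h1 h2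
      · intro a b hab hb h1 h2
        simp only [hb, show a < j by omega, show a + 1 < j by omega, if_true] at h1 h2
        exact H.av' a b hab (by omega) h1 h2
    have hhigh : ∀ i, j ≤ i → i < n + 1 → j ≤ g i := by
      intro i hi hin
      by_contra hc
      obtain ⟨k, hk, h⟩ := Hp.surj (g i) (by omega)
      simp only [hk, if_true] at h
      have := H.inj k i (by omega) hin h
      omega
    have hj1 : g (j+1) = j := by
      obtain ⟨k, hk, h⟩ := H.surj j (by omega)
      by_contra hc
      have h1 : k ≠ j + 1 := fun h' => hc (by rw [← h']; exact h)
      have h2 : k ≠ j := fun h' => by rw [h'] at h; omega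
      have h3 : ¬ k < j := fun h' => by have := hlow k h'; omega
      have h4 := hhigh (j+1) (by omega) (by omega)
      have h5 := hlt (j+1) (by omega) (by omega)
      exact H.av' j k (by omega) hk (by omega) (by omega)
    obtain ⟨m, hm⟩ : ∃ m, n = j + (m + 1) := ⟨n - j - 1, by omega⟩
    have hmid : ∀ i, i < m → j + 1 ≤ g (j + 2 + i) ∧ g (j + 2 + i) < j + 1 + m := by
      intro i hi
      have h1 := hhigh (j+2+i) (by omega) (by omega)
      have h2 := hlt (j+2+i) (by omega) (by omega)
      have h3 : g (j+2+i) ≠ j := fun h => by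
        have := H.inj (j+2+i) (j+1) (by omega) (by omega) (by omega)
        omega
      omega
    have Hq : IsG m (fun i => if i < m then g (j + 2 + i) - (j+1) else i) := by
      constructor
      · intro i hi
        have := hmid i hi
        simp only [hi, if_true]; omega
      · intro i k hi hk h
        have := hmid i hi
        have := hmid k hk
        simp only [hi, hk, if_true] at h
        have := H.inj (j+2+i) (j+2+k) (by omega) (by omega) (by omega)
        omega
      · intro i hi; simp; omega
      · intro a b c hab hbc hc h1 h2
        have := hmid a (by omega)
        have := hmid b (by omega)
        have := hmid c (by omega)
        simp only [hc, show a < m by omega, show b < m by omega, if_true] at h1 h2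
        exact H.av (j+2+a) (j+2+b) (j+2+c) (by omega) (by omega) (by omega) (by omega) (by omega)
      · intro a b hab hb h1 h2
        have := hmid a (by omega)
        have := hmid (a+1) (by omega)
        have := hmid b (by omega)
        simp only [hb, show a < m by omega, show a + 1 < m by omega, if_true] at h1 h2
        exact H.av' (j+2+a) (j+2+b) (by omega) (by omega)
          (by rw [show j + 2 + a + 1 = j + 2 + (a + 1) by omega]; omega)
          (by rw [show j + 2 + a + 1 = j + 2 + (a + 1) by omega]; omega)
    obtain ⟨t, ht, hFt⟩ := ih j (by omega) _ Hp
    obtain ⟨b, hb, hFb⟩ := ih m (by omega) _ Hq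
    refine ⟨ud t b, by simp only [size]; omega, ?_⟩
    funext i
    rcases Nat.lt_or_ge i j with h1 | h1
    · rw [F_lt t b i (by omega), hFt]; simp [h1]
    rcases Nat.lt_or_ge i (j+2) with h2 | h2
    · rcases (by omega : i = j ∨ i = j + 1) with rfl | rfl
      · have := F_at t b
        rw [ht] at this; omega
      · have := F_at1 t b
        rw [ht] at this; omega
    rcases Nat.lt_or_ge i (n+1) with h3 | h3
    · obtain ⟨k, rfl⟩ : ∃ k, i = j + 2 + k := ⟨i - (j+2), by omega⟩
      have h4 := F_mid t b k (by omega)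
      have h5 := hmid k (by omega)
      rw [ht, hFb] at h4
      simp only [show k < m by omega, if_true] at h4
      omega
    · rw [F_out t b i (by omega), H.out i h3]
  · obtain rfl : j = n := by omega
    have H' : IsG j g := by
      constructor
      · intro i hi; exact hlt i (by omega) (by omega)
      · intro i k hi hk; exact H.inj i k (by omega) (by omega)
      · intro i hi
        rcases Nat.lt_or_ge j i with h | h
        · exact H.out i h
        · obtain rfl : i = j := by omega
          exact hgj
      · intro a b c h1 h2 h3; exact H.av a b c h1 h2 (by omega)
      · intro a b h1 h2; exact H.av' a b h1 (by omega)
    obtain ⟨t, ht, hF⟩ := ih j (by omega) g H'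
    exact ⟨hor t, by simp [size, ht], hF⟩

theorem cnt_F (t : MT) : ∀ k : ℕ,
    (∑ i ∈ Finset.range t.size, if F t i = i + k then 1 else 0) = st k t := by
  induction t with
  | nil => intro k; simp [size, st]
  | hor t ih =>
    intro k
    simp only [size, st]
    rw [Finset.sum_range_succ]
    congr 1
    · exact ih k
    · have := (isG_F t).out t.size le_rfl
      simp [F, this]
  | ud t b iht ihb =>
    intro k
    simp only [size, st]
    rw [Finset.sum_range_add]
    congr 1
    · rw [← iht k]
      apply Finset.sum_congr rfl
      intro i hi
      rw [F_lt t b i (by simpa using hi)]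
    · rw [Finset.sum_range_succ', Finset.sum_range_succ']
      rw [add_assoc]
      congr 1
      · rw [← ihb (k+1)]
        apply Finset.sum_congr rfl
        intro i hi
        have := F_mid t b i (by simpa using hi)
        rw [show t.size + (i + 1 + 1) = t.size + 2 + i by omega, this]
        congr 1
        simp only [eq_iff_iff]
        omega
      · simp only [zero_add, add_zero, F_at, F_at1]
        rw [if_neg (by omega), zero_add]
        congr 1
        simp only [eq_iff_iff]
        omega

/-- Extension of a permutation by the identity. -/
def ext {n : ℕ} (π : Equiv.Perm (Fin n)) : ℕ → ℕ :=
  fun i => if h : i < n then (π ⟨i, h⟩ : ℕ) else i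

theorem ext_fin {n : ℕ} (π : Equiv.Perm (Fin n)) (i : Fin n) : ext π i = π i := by
  simp [ext]

theorem ext_inj {n : ℕ} {π ρ : Equiv.Perm (Fin n)} (h : ext π = ext ρ) : π = ρ := by
  ext i
  rw [← ext_fin, h, ext_fin]

theorem isG_ext {n : ℕ} (π : Equiv.Perm (Fin n)) :
    IsG n (ext π) ↔ Avoids231 π ∧ Avoids32_1 π := by
  constructor
  · intro H
    constructor
    · rintro ⟨i, j, k, h1, h2, h3, h4⟩
      refine H.av i j k h1 h2 k.2 ?_ ?_
      · rw [ext_fin, ext_fin]; exact h3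
      · rw [ext_fin, ext_fin]; exact h4
    · rintro ⟨a, b, h, h1, h2, h3⟩
      refine H.av' a b h1 b.2 ?_ ?_
      · rw [ext_fin]; simpa [ext, h] using h2
      · rw [ext_fin]; simpa [ext, h] using h3
  · rintro ⟨h1, h2⟩
    constructor
    · intro i hi; simp [ext, hi]
    · intro i j hi hj h
      simp only [ext, hi, hj, dif_pos] at h
      simpa using π.injective (Fin.ext h)
    · intro i hi; simp [ext]; omega
    · intro i j k hij hjk hk h3 h4
      simp only [ext, hk, show i < n by omega, show j < n by omega, dif_pos] at h3 h4
      exact h1 ⟨⟨i, by omega⟩, ⟨j, by omega⟩, ⟨k, hk⟩, hij, hjk, h3, h4⟩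
    · intro a b hab hb h3 h4
      simp only [ext, hb, show a < n by omega, show a + 1 < n by omega, dif_pos] at h3 h4
      exact h2 ⟨⟨a, by omega⟩, ⟨b, hb⟩, by simp; omega, hab, h3, h4⟩

theorem exists_ext {n : ℕ} {g : ℕ → ℕ} (H : IsG n g) : ∃ π : Equiv.Perm (Fin n), ext π = g := by
  let φ : Fin n → Fin n := fun i => ⟨g i, H.lt i i.2⟩
  have hφ : Function.Injective φ := by
    intro i j h
    simp only [φ, Fin.mk.injEq] at h
    exact Fin.ext (H.inj i j i.2 j.2 h)
  refine ⟨Equiv.ofBijective φ (Finite.injective_iff_bijective.mp hφ), ?_⟩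
  funext i
  rcases Nat.lt_or_ge i n with h | h
  · simp [ext, h, φ]
  · rw [H.out i h]; simp [ext]; omega

theorem fp_ext {n : ℕ} (π : Equiv.Perm (Fin n)) :
    fp π = ∑ i ∈ Finset.range n, if ext π i = i + 0 then 1 else 0 := by
  rw [Finset.sum_range, fp, Nat.card_eq_fintype_card, Fintype.card_subtype, Finset.card_filter]
  apply Finset.sum_congr rfl
  intro i _
  rw [ext_fin, add_zero]
  simp only [Fin.ext_iff]

theorem card_perm (n f : ℕ) :
    Nat.card {t : MT // t.size = n ∧ st 0 t = f} =
    Nat.card {π : Equiv.Perm (Fin n) // Avoids231 π ∧ Avoids32_1 π ∧ fp π = f} := by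
  have key : ∀ t : MT, t.size = n → ∃ π : Equiv.Perm (Fin n), ext π = F t := by
    rintro t rfl
    exact exists_ext (isG_F t)
  choose φ hφ using key
  have hfp : ∀ t (h : t.size = n), fp (φ t h) = st 0 t := by
    rintro t rfl
    rw [fp_ext, hφ, cnt_F]
  apply Nat.card_congr
  refine Equiv.ofBijective (fun t => ⟨φ t.1 t.2.1, ?_⟩) ⟨?_, ?_⟩
  · rw [← and_assoc]
    refine ⟨?_, ?_⟩
    · rw [← isG_ext, hφ]
      have := isG_F t.1
      rwa [t.2.1] at this
    · rw [hfp]; exact t.2.2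
  · rintro ⟨t, h1, h2⟩ ⟨t', h1', h2'⟩ h
    simp only [Subtype.mk.injEq] at h ⊢
    apply F_inj _ _ (by omega)
    rw [← hφ t h1, h, hφ]
  · rintro ⟨π, h1, h2, h3⟩
    obtain ⟨t, ht, hF⟩ := exists_F n _ ((isG_ext π).2 ⟨h1, h2⟩)
    have e : φ t ht = π := ext_inj (by rw [hφ, hF])
    refine ⟨⟨t, ht, ?_⟩, ?_⟩
    · rw [← hfp t ht, e, h3]
    · simp [e]

theorem card_path (n f : ℕ) :
    Nat.card {t : MT // t.size = n ∧ st 0 t = f} =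
    Nat.card {P : List MStep // IsMotzkinPath P ∧ P.length = n ∧
        horAtZero P + goodTunnels P = f} := by
  apply Nat.card_congr
  refine Equiv.ofBijective (fun t => ⟨L t.1, isM_L t.1, ?_, ?_⟩) ⟨?_, ?_⟩
  · rw [length_L]; exact t.2.1
  · rw [stat_eq]; exact t.2.2
  · rintro ⟨t, h1, h2⟩ ⟨t', h1', h2'⟩ h
    simp only [Subtype.mk.injEq] at h ⊢
    exact L_inj h
  · rintro ⟨P, h1, h2, h3⟩
    obtain ⟨t, rfl⟩ := exists_L h1
    exact ⟨⟨t, by rw [← length_L]; exact h2, by rw [← stat_eq]; exact h3⟩, rfl⟩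

/-- The number of permutations of `[n]` avoiding 231 and 32-1 with exactly `f` fixed points
equals the number of Motzkin paths `P` of length `n` with `h₀(P) + g(P) = f`. -/
theorem card_fixed_points_eq_card_motzkin_paths (n f : ℕ) :
    Nat.card {π : Equiv.Perm (Fin n) // Avoids231 π ∧ Avoids32_1 π ∧ fp π = f} =
      Nat.card {P : List MStep // IsMotzkinPath P ∧ P.length = n ∧
        horAtZero P + goodTunnels P = f} := by
  rw [← card_perm, card_path]
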